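/- arXiv:2012.11359 — 2 statements merged into one kernel-verified Lean document; each statement's English description precedes it below -/
import Mathlib

section
/- For every X in A, the matrix identity M_Xᵀ * M_X = a(X) • (1 : Matrix (Fin 8) (Fin 8) ℝ) + b(X) • J holds. -/
open Matrix

noncomputable section

/-- Standard basis vectors of `A := Fin 8 → ℝ`: `e i j = 1` if `i = j`, else `0`. -/
def e (i : Fin 8) : Fin 8 → ℝ := fun j => if i = j then 1 else 0

/-- The octonion-like (split-biquaternion) product on `Fin 8 → ℝ`: the unique bilinear
multiplication determined by the multiplication table on the basis `e 0, …, e 7`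
(with `e 0` the two-sided identity, `e 7 · e 7 = e 0`, `e i · e i = -e 0` for `1 ≤ i ≤ 6`, etc.),
written out in coordinates. -/
def omul (X Y : Fin 8 → ℝ) : Fin 8 → ℝ :=
  ![X 0*Y 0 - X 1*Y 1 - X 2*Y 2 - X 3*Y 3 - X 4*Y 4 - X 5*Y 5 - X 6*Y 6 + X 7*Y 7,
    X 1*Y 0 + X 0*Y 1 - X 3*Y 2 + X 2*Y 3 + X 5*Y 4 - X 4*Y 5 - X 7*Y 6 - X 6*Y 7,
    X 2*Y 0 + X 3*Y 1 + X 0*Y 2 - X 1*Y 3 - X 6*Y 4 - X 7*Y 5 + X 4*Y 6 - X 5*Y 7,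
    X 3*Y 0 - X 2*Y 1 + X 1*Y 2 + X 0*Y 3 - X 7*Y 4 + X 6*Y 5 - X 5*Y 6 - X 4*Y 7,
    X 4*Y 0 - X 5*Y 1 + X 6*Y 2 - X 7*Y 3 + X 0*Y 4 + X 1*Y 5 - X 2*Y 6 - X 3*Y 7,
    X 5*Y 0 + X 4*Y 1 - X 7*Y 2 - X 6*Y 3 - X 1*Y 4 + X 0*Y 5 + X 3*Y 6 - X 2*Y 7,
    X 6*Y 0 - X 7*Y 1 - X 4*Y 2 + X 5*Y 3 + X 2*Y 4 - X 3*Y 5 + X 0*Y 6 - X 1*Y 7,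
    X 7*Y 0 + X 6*Y 1 + X 5*Y 2 + X 4*Y 3 + X 3*Y 4 + X 2*Y 5 + X 1*Y 6 + X 0*Y 7]

/-- The conjugate (reverse) of `X`: negate the six imaginary coordinates `1,…,6`. -/
def oconj (X : Fin 8 → ℝ) : Fin 8 → ℝ :=
  ![X 0, -X 1, -X 2, -X 3, -X 4, -X 5, -X 6, X 7]

/-- `a(X) = ∑ i, (X i)²`. -/
def aQ (X : Fin 8 → ℝ) : ℝ := ∑ i, (X i)^2

/-- `b(X) = 2 X₀X₇ − 2 (X₁X₆ + X₂X₅ + X₃X₄)`. -/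
def bQ (X : Fin 8 → ℝ) : ℝ := 2*(X 0)*(X 7) - 2*((X 1)*(X 6) + (X 2)*(X 5) + (X 3)*(X 4))

/-- Squared seminorm `N_λ(X) = a(X) + λ·b(X)` (used with `λ = 1` and `λ = -1`). -/
def Nsq (lam : ℝ) (X : Fin 8 → ℝ) : ℝ := aQ X + lam * bQ X

/-- Matrix of left multiplication by `X`: column `j` is the coordinate vector of `X · eⱼ`. -/
def MX (X : Fin 8 → ℝ) : Matrix (Fin 8) (Fin 8) ℝ := Matrix.of fun i j => omul X (e j) i

/-- Matrix of right multiplication by `X`: column `j` is the coordinate vector of `eⱼ · X`. -/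
def PX (X : Fin 8 → ℝ) : Matrix (Fin 8) (Fin 8) ℝ := Matrix.of fun i j => omul (e j) X i

/-- The matrix `J` with `matJ 0 7 = matJ 7 0 = 1`, `matJ i (7-i) = -1` for `1 ≤ i ≤ 6`, else `0`. -/
def matJ : Matrix (Fin 8) (Fin 8) ℝ :=
  !![0, 0, 0, 0, 0, 0, 0, 1;
     0, 0, 0, 0, 0, 0, -1, 0;
     0, 0, 0, 0, 0, -1, 0, 0;
     0, 0, 0, 0, -1, 0, 0, 0;
     0, 0, 0, -1, 0, 0, 0, 0;
     0, 0, -1, 0, 0, 0, 0, 0;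
     0, -1, 0, 0, 0, 0, 0, 0;
     1, 0, 0, 0, 0, 0, 0, 0]

set_option maxHeartbeats 8000000 in
/-- `M_Xᵀ * M_X = a(X) • 1 + b(X) • matJ`. -/
theorem MX_transpose_mul_MX (X : Fin 8 → ℝ) :
    (MX X)ᵀ * MX X = aQ X • (1 : Matrix (Fin 8) (Fin 8) ℝ) + bQ X • matJ := by
  have hM : MX X = !![X 0, -X 1, -X 2, -X 3, -X 4, -X 5, -X 6, X 7;
      X 1, X 0, -X 3, X 2, X 5, -X 4, -X 7, -X 6;
      X 2, X 3, X 0, -X 1, -X 6, -X 7, X 4, -X 5;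
      X 3, -X 2, X 1, X 0, -X 7, X 6, -X 5, -X 4;
      X 4, -X 5, X 6, -X 7, X 0, X 1, -X 2, -X 3;
      X 5, X 4, -X 7, -X 6, -X 1, X 0, X 3, -X 2;
      X 6, -X 7, -X 4, X 5, X 2, -X 3, X 0, -X 1;
      X 7, X 6, X 5, X 4, X 3, X 2, X 1, X 0] := by
    ext i j
    fin_cases i <;> fin_cases j <;> simp [MX, omul, e]
  rw [hM]
  ext i j
  fin_cases i <;> fin_cases j <;>
    simp [Matrix.mul_apply, Fin.sum_univ_eight, matJ, aQ, bQ, Matrix.one_apply] <;> ring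
end
end

section
/- For every X in A, the determinant of the left-multiplication matrix satisfies det M_X = (a(X) + b(X))² · (a(X) − b(X))². -/
noncomputable section

/-- The matrix `J` with `J 0 7 = J 7 0 = 1`, `J i (7-i) = -1` for `1 ≤ i ≤ 6`, else `0`. -/
def J : Matrix (Fin 8) (Fin 8) ℝ :=
  !![0, 0, 0, 0, 0, 0, 0, 1;
     0, 0, 0, 0, 0, 0, -1, 0;
     0, 0, 0, 0, 0, -1, 0, 0;
     0, 0, 0, 0, -1, 0, 0, 0;
     0, 0, 0, -1, 0, 0, 0, 0;
     0, 0, -1, 0, 0, 0, 0, 0;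
     0, -1, 0, 0, 0, 0, 0, 0;
     1, 0, 0, 0, 0, 0, 0, 0]

set_option maxHeartbeats 4000000

def qmat (p q r s : ℝ) : Matrix (Fin 4) (Fin 4) ℝ :=
  !![p, -q, -r, -s; q, p, -s, r; r, s, p, -q; s, -r, q, p]

theorem qmat_det (p q r s : ℝ) : (qmat p q r s).det = (p^2 + q^2 + r^2 + s^2)^2 := by
  simp [qmat, Matrix.det_succ_row_zero, Fin.sum_univ_succ, Fin.succAbove]
  ring

def sgnS : Matrix (Fin 4) (Fin 4) ℝ :=
  !![1, 0, 0, 0; 0, -1, 0, 0; 0, 0, -1, 0; 0, 0, 0, -1]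

def reix : Fin 4 ⊕ Fin 4 → Fin 8 := Sum.elim ![0, 1, 2, 3] ![7, 6, 5, 4]

theorem reix_bij : Function.Bijective reix := by decide

theorem omul_r0 (X Y : Fin 8 → ℝ) : omul X Y 0 =
    X 0*Y 0 - X 1*Y 1 - X 2*Y 2 - X 3*Y 3 - X 4*Y 4 - X 5*Y 5 - X 6*Y 6 + X 7*Y 7 := rfl

theorem omul_r1 (X Y : Fin 8 → ℝ) : omul X Y 1 =
    X 1*Y 0 + X 0*Y 1 - X 3*Y 2 + X 2*Y 3 + X 5*Y 4 - X 4*Y 5 - X 7*Y 6 - X 6*Y 7 := rfl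

theorem omul_r2 (X Y : Fin 8 → ℝ) : omul X Y 2 =
    X 2*Y 0 + X 3*Y 1 + X 0*Y 2 - X 1*Y 3 - X 6*Y 4 - X 7*Y 5 + X 4*Y 6 - X 5*Y 7 := rfl

theorem omul_r3 (X Y : Fin 8 → ℝ) : omul X Y 3 =
    X 3*Y 0 - X 2*Y 1 + X 1*Y 2 + X 0*Y 3 - X 7*Y 4 + X 6*Y 5 - X 5*Y 6 - X 4*Y 7 := rfl

theorem omul_r4 (X Y : Fin 8 → ℝ) : omul X Y 4 =
    X 4*Y 0 - X 5*Y 1 + X 6*Y 2 - X 7*Y 3 + X 0*Y 4 + X 1*Y 5 - X 2*Y 6 - X 3*Y 7 := rfl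

theorem omul_r5 (X Y : Fin 8 → ℝ) : omul X Y 5 =
    X 5*Y 0 + X 4*Y 1 - X 7*Y 2 - X 6*Y 3 - X 1*Y 4 + X 0*Y 5 + X 3*Y 6 - X 2*Y 7 := rfl

theorem omul_r6 (X Y : Fin 8 → ℝ) : omul X Y 6 =
    X 6*Y 0 - X 7*Y 1 - X 4*Y 2 + X 5*Y 3 + X 2*Y 4 - X 3*Y 5 + X 0*Y 6 - X 1*Y 7 := rfl

theorem omul_r7 (X Y : Fin 8 → ℝ) : omul X Y 7 =
    X 7*Y 0 + X 6*Y 1 + X 5*Y 2 + X 4*Y 3 + X 3*Y 4 + X 2*Y 5 + X 1*Y 6 + X 0*Y 7 := rfl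

theorem MX_blocks (X : Fin 8 → ℝ) : (MX X).submatrix reix reix = Matrix.fromBlocks
    (!![X 0, -X 1, -X 2, -X 3;
      X 1, X 0, -X 3, X 2;
      X 2, X 3, X 0, -X 1;
      X 3, -X 2, X 1, X 0])
    (!![X 7, -X 6, -X 5, -X 4;
      -X 6, -X 7, -X 4, X 5;
      -X 5, X 4, -X 7, -X 6;
      -X 4, -X 5, X 6, -X 7])
    (!![X 7, X 6, X 5, X 4;
      X 6, -X 7, -X 4, X 5;
      X 5, X 4, -X 7, -X 6;
      X 4, -X 5, X 6, -X 7])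
    (!![X 0, X 1, X 2, X 3;
      -X 1, X 0, -X 3, X 2;
      -X 2, X 3, X 0, -X 1;
      -X 3, -X 2, X 1, X 0]) := by
  ext i j
  rcases i with i | i <;> rcases j with j | j <;> fin_cases i <;> fin_cases j <;>
    simp [MX, e, reix, omul_r0, omul_r1, omul_r2, omul_r3, omul_r4, omul_r5, omul_r6, omul_r7]

/-- `det M_X = (a(X) + b(X))² · (a(X) − b(X))²`. -/
theorem det_MX (X : Fin 8 → ℝ) :
    (MX X).det = (aQ X + bQ X)^2 * (aQ X - bQ X)^2 := by
  have h1 : (MX X).det = ((MX X).submatrix reix reix).det :=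
    (Matrix.det_submatrix_equiv_self (Equiv.ofBijective reix reix_bij) (MX X)).symm
  have h2 : (MX X).submatrix reix reix * Matrix.fromBlocks 1 0 sgnS 1 =
      Matrix.fromBlocks 1 0 sgnS 1 * Matrix.fromBlocks
        (qmat (X 0 + X 7) (X 1 - X 6) (X 2 - X 5) (X 3 - X 4))
        (!![X 7, -X 6, -X 5, -X 4;
      -X 6, -X 7, -X 4, X 5;
      -X 5, X 4, -X 7, -X 6;
      -X 4, -X 5, X 6, -X 7])
        0 (sgnS * qmat (X 0 - X 7) (X 1 + X 6) (X 2 + X 5) (X 3 + X 4) * sgnS) := by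
    rw [MX_blocks, Matrix.fromBlocks_multiply, Matrix.fromBlocks_multiply]
    simp only [Matrix.mul_one, Matrix.one_mul, Matrix.mul_zero, Matrix.zero_mul, zero_add,
      add_zero]
    congr 1 <;> ext i j <;> fin_cases i <;> fin_cases j <;>
      simp [qmat, sgnS] <;> ring
  have hS : sgnS.det = -1 := by
    simp [sgnS, Matrix.det_succ_row_zero, Fin.sum_univ_succ, Fin.succAbove]
  have h3 := congrArg Matrix.det h2
  rw [Matrix.det_mul, Matrix.det_mul, Matrix.det_fromBlocks_zero₁₂, Matrix.det_fromBlocks_zero₂₁,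
    Matrix.det_mul, Matrix.det_mul, hS, qmat_det, qmat_det, Matrix.det_one] at h3
  have ha : aQ X = X 0^2 + X 1^2 + X 2^2 + X 3^2 + X 4^2 + X 5^2 + X 6^2 + X 7^2 := by
    simp [aQ, Fin.sum_univ_eight]
  rw [h1, ha, bQ]
  linear_combination h3
end
end
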